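/- If Z ~ N(g, 1) and q ≥ 1, then g²/q − (1/(6q))(1 − 1/q) g⁴ ≤ c_q E[|Z|^{2/q}] − 1 ≤ g²/q, where c_q = √π/(2^{1/q} Γ(1/2 + 1/q)). -/

import Mathlib

open MeasureTheory ProbabilityTheory Real

noncomputable def cqP (a : ℝ) (k : ℕ) : ℝ := ∏ j ∈ Finset.range k, (1 + 2 * a / (2 * (j : ℝ) + 1))

lemma cqP_succ (a : ℝ) (k : ℕ) : cqP a (k + 1) = cqP a k * (1 + 2 * a / (2 * (k : ℝ) + 1)) :=
  Finset.prod_range_succ _ _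

lemma cqP_nonneg {a : ℝ} (ha : 0 ≤ a) (k : ℕ) : 0 ≤ cqP a k :=
  Finset.prod_nonneg fun j _ => by positivity

lemma cqP_le {a : ℝ} (ha : 0 ≤ a) (ha1 : a ≤ 1) (k : ℕ) : cqP a k ≤ 1 + 2 * a * k := by
  induction k with
  | zero => simp [cqP]
  | succ k ih =>
    rw [cqP_succ]
    have hk : (0 : ℝ) ≤ k := k.cast_nonneg
    refine (mul_le_mul_of_nonneg_right ih (by positivity)).trans ?_
    have h : (1 + 2 * a * k) * (2 * a / (2 * (k : ℝ) + 1)) ≤ 2 * a := by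
      rw [← mul_div_assoc, div_le_iff₀ (by positivity)]
      nlinarith [mul_nonneg (mul_nonneg ha hk) (sub_nonneg.2 ha1)]
    push_cast
    nlinarith

lemma cqP_ge1 {a : ℝ} (ha : 0 ≤ a) (ha1 : a ≤ 1) (k : ℕ) :
    (2 * (k : ℝ) + 1) * (1 - 2 / 3 * (1 - a) * k) ≤ cqP a k := by
  induction k with
  | zero => simp [cqP]
  | succ k ih =>
    rw [cqP_succ]
    have hk : (0 : ℝ) ≤ k := k.cast_nonneg
    refine le_trans ?_ (mul_le_mul_of_nonneg_right ih (by positivity))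
    have h : (2 * (k : ℝ) + 1) * (1 - 2 / 3 * (1 - a) * k) * (1 + 2 * a / (2 * (k : ℝ) + 1))
      = (1 - 2 / 3 * (1 - a) * k) * (2 * k + 1 + 2 * a) := by
      field_simp
    rw [h]
    push_cast
    nlinarith [mul_nonneg hk (sub_nonneg.2 ha1), mul_nonneg hk (sq_nonneg (1 - a))]

lemma cqP_ge {a : ℝ} (ha : 0 ≤ a) (ha1 : a ≤ 1) (k : ℕ) :
    1 + 2 * a * k - 2 / 3 * a * (1 - a) * (k * (k - 1)) ≤ cqP a k := by
  induction k with
  | zero => simp [cqP]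
  | succ k ih =>
    rw [cqP_succ]
    have hk : (0 : ℝ) ≤ k := k.cast_nonneg
    have h2 := mul_le_mul_of_nonneg_right (cqP_ge1 ha ha1 k)
      (show (0 : ℝ) ≤ 2 * a / (2 * (k : ℝ) + 1) by positivity)
    have h : (2 * (k : ℝ) + 1) * (1 - 2 / 3 * (1 - a) * k) * (2 * a / (2 * (k : ℝ) + 1))
      = (1 - 2 / 3 * (1 - a) * k) * (2 * a) := by
      field_simp
    rw [h] at h2
    push_cast
    nlinarith

lemma cq_conv {f f' : ℕ → ℝ} {s s' : ℝ} (h : HasSum f s) (hf : ∀ k, f' k = f k) (hs : s' = s) :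
    HasSum f' s' := by
  rw [hs, funext hf]; exact h

lemma cq_hasSum0 (z : ℝ) : HasSum (fun k : ℕ => z ^ k / (k.factorial : ℝ)) (exp z) := by
  rw [Real.exp_eq_exp_ℝ]
  exact NormedSpace.expSeries_div_hasSum_exp z

lemma cq_hasSum1 (z : ℝ) :
    HasSum (fun k : ℕ => (k : ℝ) * (z ^ k / (k.factorial : ℝ))) (z * exp z) := by
  rw [← hasSum_nat_add_iff' 1]
  have h := (cq_hasSum0 z).mul_left z
  refine cq_conv (h) (fun k => ?_) ?_
  · try beta_reduce
    rw [Nat.factorial_succ]; push_cast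
    field_simp
    ring
  · simp

lemma cq_hasSum2 (z : ℝ) :
    HasSum (fun k : ℕ => (k : ℝ) * (k - 1) * (z ^ k / (k.factorial : ℝ))) (z ^ 2 * exp z) := by
  rw [← hasSum_nat_add_iff' 1]
  have h := (cq_hasSum1 z).mul_left z
  refine cq_conv (h) (fun k => ?_) ?_
  · try beta_reduce
    rw [Nat.factorial_succ]; push_cast
    field_simp
    ring
  · simp; ring

lemma cq_hasSum_up (a z : ℝ) :
    HasSum (fun k : ℕ => (1 + 2 * a * k) * (z ^ k / (k.factorial : ℝ)))
      ((1 + 2 * a * z) * exp z) := by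
  refine cq_conv ((cq_hasSum0 z).add ((cq_hasSum1 z).mul_left (2 * a))) (fun k => ?_) ?_
  · ring
  · ring

lemma cq_hasSum_lo (a z : ℝ) :
    HasSum (fun k : ℕ => (1 + 2 * a * k - 2 / 3 * a * (1 - a) * (k * (k - 1)))
      * (z ^ k / (k.factorial : ℝ)))
      ((1 + 2 * a * z - 2 / 3 * a * (1 - a) * z ^ 2) * exp z) := by
  refine cq_conv ((cq_hasSum_up a z).sub ((cq_hasSum2 z).mul_left (2 / 3 * a * (1 - a)))) (fun k => ?_) ?_
  · ring
  · ring

lemma cqP_summable {a z : ℝ} (ha : 0 ≤ a) (ha1 : a ≤ 1) (hz : 0 ≤ z) :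
    Summable (fun k : ℕ => cqP a k * (z ^ k / (k.factorial : ℝ))) :=
  Summable.of_nonneg_of_le (fun k => mul_nonneg (cqP_nonneg ha k) (by positivity))
    (fun k => mul_le_mul_of_nonneg_right (cqP_le ha ha1 k) (by positivity))
    (cq_hasSum_up a z).summable

lemma cq_J {a : ℝ} (ha : 0 ≤ a) (k : ℕ) :
    ∫ x in Set.Ioi (0 : ℝ), x ^ (2 * a + 2 * k) * exp (-(1 / 2) * x ^ 2)
      = (2 : ℝ) ^ (a + k - 1 / 2) * Gamma (a + k + 1 / 2) := by
  have h := integral_rpow_mul_exp_neg_mul_rpow (p := 2) (q := 2 * a + 2 * k) (b := 1 / 2)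
    two_pos (by have : (0 : ℝ) ≤ k := k.cast_nonneg
                linarith) (by norm_num)
  simp only [Real.rpow_two] at h
  rw [h]
  have e : (2 * a + 2 * k + 1) / 2 = a + k + 1 / 2 := by ring
  have e' : -(2 * a + 2 * k + 1) / 2 = -(a + k + 1 / 2) := by ring
  rw [e, e', one_div, Real.inv_rpow (by norm_num), Real.rpow_neg (by norm_num), inv_inv]
  have : (a + k + 2⁻¹ : ℝ) = (a + k - 2⁻¹) + 1 := by ring
  rw [this, Real.rpow_add (by norm_num), Real.rpow_one]
  ring

lemma cq_Gamma {a : ℝ} (ha : 0 ≤ a) (k : ℕ) :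
    (2 : ℝ) ^ (a + k - 1 / 2) * Gamma (a + k + 1 / 2) / ((2 * k).factorial : ℝ)
      = (2 : ℝ) ^ (a - 1 / 2) * Gamma (a + 1 / 2) * cqP a k / (2 ^ k * (k.factorial : ℝ)) := by
  induction k with
  | zero => simp [cqP]
  | succ k ih =>
    have hk : (0 : ℝ) ≤ k := k.cast_nonneg
    rw [cqP_succ]
    have e1 : (a + ((k + 1 : ℕ) : ℝ) - 1 / 2) = (a + k - 1 / 2) + 1 := by push_cast; ring
    have e2 : (a + ((k + 1 : ℕ) : ℝ) + 1 / 2) = (a + k + 1 / 2) + 1 := by push_cast; ring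
    rw [e1, e2, Real.rpow_add (by norm_num), Real.rpow_one, Real.Gamma_add_one (by positivity)]
    have e3 : ((2 * (k + 1)).factorial : ℝ) = (2 * k + 2) * (2 * k + 1) * (2 * k).factorial := by
      rw [show 2 * (k + 1) = 2 * k + 1 + 1 by ring, Nat.factorial_succ, Nat.factorial_succ]
      push_cast; ring
    have e4 : ((k + 1).factorial : ℝ) = (k + 1) * k.factorial := by
      rw [Nat.factorial_succ]; push_cast; ring
    have t1 : (2 : ℝ) ^ (a + k - 1 / 2) * 2 * ((a + k + 1 / 2) * Gamma (a + k + 1 / 2))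
        / ((2 * (k + 1)).factorial : ℝ)
        = ((2 : ℝ) ^ (a + k - 1 / 2) * Gamma (a + k + 1 / 2) / ((2 * k).factorial : ℝ))
          * (2 * (a + k + 1 / 2) / ((2 * k + 2) * (2 * k + 1))) := by
      rw [e3, div_mul_div_comm]; congr 1 <;> ring
    rw [t1, ih, e4, pow_succ]
    field_simp
    ring

lemma cq_series {a : ℝ} (g : ℝ) (ha : 0 ≤ a) (ha1 : a ≤ 1) :
    HasSum (fun k : ℕ => (2 : ℝ) ^ (a - 1 / 2) * Gamma (a + 1 / 2)
        * (cqP a k * ((g ^ 2 / 2) ^ k / (k.factorial : ℝ))))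
      (∫ x in Set.Ioi (0 : ℝ), cosh (g * x) * (x ^ (2 * a) * exp (-(1 / 2) * x ^ 2))) := by
  set F : ℕ → ℝ → ℝ := fun k x =>
    g ^ (2 * k) / ((2 * k).factorial : ℝ) * (x ^ (2 * a + 2 * k) * exp (-(1 / 2) * x ^ 2)) with hF
  have hint : ∀ k, ∫ x in Set.Ioi (0 : ℝ), F k x = (2 : ℝ) ^ (a - 1 / 2) * Gamma (a + 1 / 2)
        * (cqP a k * ((g ^ 2 / 2) ^ k / (k.factorial : ℝ))) := by
    intro k
    simp only [hF]
    rw [integral_const_mul, cq_J ha, div_mul_eq_mul_div, mul_div_assoc, cq_Gamma ha, pow_mul,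
      div_pow]
    field_simp
  have hI : ∀ k, Integrable (F k) (volume.restrict (Set.Ioi (0 : ℝ))) := by
    intro k
    have hk : (0 : ℝ) ≤ k := k.cast_nonneg
    exact (integrableOn_rpow_mul_exp_neg_mul_sq (by norm_num) (by linarith)).const_mul _
  have hn : ∀ k, ∫ x in Set.Ioi (0 : ℝ), ‖F k x‖ = ∫ x in Set.Ioi (0 : ℝ), F k x := by
    intro k
    refine setIntegral_congr_fun measurableSet_Ioi fun x hx => ?_
    have hx' : (0 : ℝ) < x := hx
    refine Real.norm_of_nonneg ?_
    simp only [hF, pow_mul]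
    positivity
  have hs : Summable fun k => ∫ x in Set.Ioi (0 : ℝ), ‖F k x‖ := by
    simp_rw [hn, hint]
    exact (cqP_summable ha ha1 (by positivity)).mul_left _
  have h := hasSum_integral_of_summable_integral_norm hI hs
  simp_rw [hint] at h
  refine cq_conv h (fun _ => rfl) ?_
  refine setIntegral_congr_fun measurableSet_Ioi fun x hx => ?_
  have hx' : (0 : ℝ) < x := hx
  have h2 := (Real.hasSum_cosh (g * x)).mul_right (x ^ (2 * a) * exp (-(1 / 2) * x ^ 2))
  refine Eq.trans h2.tsum_eq.symm ?_
  refine tsum_congr fun k => ?_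
  simp only [hF]
  rw [Real.rpow_add hx', mul_pow]
  have : x ^ (2 * (k : ℝ)) = x ^ (2 * k) := by
    rw [← Real.rpow_natCast]; push_cast; rfl
  rw [this]
  ring

lemma cq_fold {a : ℝ} (g : ℝ) (ha : 0 < a) :
    ∫ x, |x| ^ (2 * a) ∂(gaussianReal g 1)
      = 2 * (√(2 * π))⁻¹ * exp (-(g ^ 2 / 2)) *
        ∫ x in Set.Ioi (0 : ℝ), cosh (g * x) * (x ^ (2 * a) * exp (-(1 / 2) * x ^ 2)) := by
  have hI : Integrable (fun x : ℝ => |x| ^ (2 * a)) (gaussianReal g 1) := by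
    have h := (memLp_id_gaussianReal (μ := g) (v := 1) (2 * a).toNNReal).integrable_norm_rpow
      (by simp [ha]) (by simp)
    have e : ((2 * a).toNNReal : ENNReal).toReal = 2 * a := by
      simp [ha.le]
    rw [e] at h
    simpa using h
  have hI2 : Integrable (fun x : ℝ => gaussianPDFReal g 1 x * |x| ^ (2 * a)) := by
    rw [gaussianReal_of_var_ne_zero g one_ne_zero,
      integrable_withDensity_iff_integrable_smul₀' (measurable_gaussianPDF _ _).aemeasurable
        (ae_of_all _ fun _ => gaussianPDF_lt_top)] at hI
    simpa using hI
  rw [integral_gaussianReal_eq_integral_smul one_ne_zero]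
  simp only [smul_eq_mul]
  set f : ℝ → ℝ := fun x => gaussianPDFReal g 1 x * |x| ^ (2 * a) with hf
  have h1 : ∫ x, f x = ∫ x, f (-x) := (integral_neg_eq_self f volume).symm
  have h2 : 2 * ∫ x, f x = ∫ x, (f x + f (-x)) := by
    rw [integral_add hI2 hI2.comp_neg, ← h1]; ring
  set G : ℝ → ℝ := fun x => 2 * (√(2 * π))⁻¹ * exp (-(g ^ 2 / 2)) *
    (cosh (g * x) * (x ^ (2 * a) * exp (-(1 / 2) * x ^ 2))) with hG
  have h3 : ∀ x, f x + f (-x) = G |x| := by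
    intro x
    have hc : cosh (g * |x|) = cosh (g * x) := by
      rcases abs_choice x with h | h <;> rw [h]
      rw [mul_neg, Real.cosh_neg]
    simp only [hf, hG, gaussianPDFReal, abs_neg, sq_abs, hc, NNReal.coe_one, mul_one]
    have e1 : -(x - g) ^ 2 / 2 = -(g ^ 2 / 2) + (g * x) + (-(1 / 2) * x ^ 2) := by ring
    have e2 : -(-x - g) ^ 2 / 2 = -(g ^ 2 / 2) + (-(g * x)) + (-(1 / 2) * x ^ 2) := by ring
    rw [e1, e2, Real.cosh_eq]
    simp only [Real.exp_add]
    ring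
  simp_rw [h3] at h2
  rw [integral_comp_abs] at h2
  have h4 : ∫ x, f x = ∫ x in Set.Ioi (0 : ℝ), G x := by linarith
  rw [h4]
  simp only [hG]
  rw [integral_const_mul]

lemma cq_main {a : ℝ} (g : ℝ) (ha : 0 < a) (ha1 : a ≤ 1) :
    HasSum (fun k : ℕ => cqP a k * ((g ^ 2 / 2) ^ k / (k.factorial : ℝ)))
      (exp (g ^ 2 / 2) * ((√π / (2 ^ a * Gamma (1 / 2 + a)))
          * (∫ x, |x| ^ (2 * a) ∂(gaussianReal g 1)))) := by
  have hG : 0 < Gamma (a + 1 / 2) := Real.Gamma_pos_of_pos (by positivity)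
  have h2 : (0 : ℝ) < 2 ^ (a - 1 / 2) := by positivity
  have h := (cq_series g ha.le ha1).mul_left ((2 : ℝ) ^ (a - 1 / 2) * Gamma (a + 1 / 2))⁻¹
  have hp : (2 : ℝ) ^ a = 2 ^ (a - 1 / 2) * √2 := by
    rw [Real.sqrt_eq_rpow, ← Real.rpow_add (by norm_num)]; congr 1; ring
  have hsq : √2 * √2 = (2 : ℝ) := Real.mul_self_sqrt (by norm_num)
  have hpi : 0 < √π := Real.sqrt_pos.2 Real.pi_pos
  refine cq_conv (h) (fun k => ?_) ?_
  · try beta_reduce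
    rw [← mul_assoc, inv_mul_cancel₀ (by positivity), one_mul]
  · rw [cq_fold g ha, hp, Real.exp_neg, Real.sqrt_mul (by norm_num), add_comm (1 / 2) a]
    have he := Real.exp_pos (g ^ 2 / 2)
    field_simp
    rw [sq, hsq]

/-- Inequality (A.1): if `Z ~ N(g,1)` and `q ≥ 1`, then with
`c_q = √π/(2^{1/q} Γ(1/2 + 1/q))`,
`g²/q − (1/(6q))(1 − 1/q)g⁴ ≤ c_q E[|Z|^{2/q}] − 1 ≤ g²/q`. -/
theorem cq_moment_bounds (g q : ℝ) (hq : 1 ≤ q) :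
    g ^ 2 / q - (1 / (6 * q)) * (1 - 1 / q) * g ^ 4
      ≤ (Real.sqrt π / (2 ^ (1 / q) * Real.Gamma (1 / 2 + 1 / q)))
          * (∫ x, |x| ^ (2 / q) ∂(gaussianReal g 1)) - 1
    ∧ (Real.sqrt π / (2 ^ (1 / q) * Real.Gamma (1 / 2 + 1 / q)))
          * (∫ x, |x| ^ (2 / q) ∂(gaussianReal g 1)) - 1
      ≤ g ^ 2 / q := by 
  have hq0 : 0 < q := by linarith
  have ha : 0 < 1 / q := by positivity
  have ha1 : 1 / q ≤ 1 := by rw [div_le_one hq0]; exact hq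
  have hm := cq_main g ha ha1
  rw [show (2 : ℝ) * (1 / q) = 2 / q by ring] at hm
  have hz : 0 ≤ g ^ 2 / 2 := by positivity
  have he := Real.exp_pos (g ^ 2 / 2)
  have hu := hasSum_le (fun k => mul_le_mul_of_nonneg_right (cqP_le ha.le ha1 k) (by positivity))
    hm (cq_hasSum_up (1 / q) (g ^ 2 / 2))
  have hl := hasSum_le (fun k => mul_le_mul_of_nonneg_right (cqP_ge ha.le ha1 k) (by positivity))
    (cq_hasSum_lo (1 / q) (g ^ 2 / 2)) hm
  rw [mul_comm (exp _)] at hu hl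
  have hu' := le_of_mul_le_mul_right hu he
  have hl' := le_of_mul_le_mul_right hl he
  constructor
  · have e : g ^ 2 / q - (1 / (6 * q)) * (1 - 1 / q) * g ^ 4
      = (1 + 2 * (1 / q) * (g ^ 2 / 2) - 2 / 3 * (1 / q) * (1 - 1 / q) * (g ^ 2 / 2) ^ 2) - 1 := by
      field_simp
      ring
    rw [e]
    linarith
  · have e : g ^ 2 / q = (1 + 2 * (1 / q) * (g ^ 2 / 2)) - 1 := by
      field_simp
      ring
    rw [e]
    linarith
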